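/- arXiv:2412.11244 — 2 statements merged into one kernel-verified Lean document; each statement's English description precedes it below -/
import Mathlib

section
/- Let X be a geodesic metric space, let β be a (λ,c)-quasi-geodesic in X with terminal endpoint q, let x ∈ X, and let a be a point on β with d(x,a) = d(x,β) (a nearest point of β to x). Then the concatenation of any geodesic [x,a] with the subpath of β from a to q is a (2λ+1, c)-quasi-geodesic. -/
open Metric Set Filter Pointwise

/-- `γ` restricted to `[0, L]` is a `(lam, c)`-quasi-geodesic parametrized by arc length:
the length of the subpath from `s` to `t` is `t - s`. -/
def IsQuasiGeodesicOn {X : Type*} [MetricSpace X] (γ : ℝ → X) (L lam c : ℝ) : Prop :=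
  (∀ s t : ℝ, 0 ≤ s → s ≤ t → t ≤ L → dist (γ s) (γ t) ≤ t - s) ∧
  (∀ s t : ℝ, 0 ≤ s → s ≤ t → t ≤ L → t - s ≤ lam * dist (γ s) (γ t) + c)

/-- `γ` restricted to `[0, L]` is a geodesic (unit speed). -/
def IsGeodesicOn {X : Type*} [MetricSpace X] (γ : ℝ → X) (L : ℝ) : Prop :=
  ∀ s t : ℝ, s ∈ Set.Icc 0 L → t ∈ Set.Icc 0 L → dist (γ s) (γ t) = |s - t|

/-- A metric space is geodesic if any two points are joined by a geodesic. -/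
def GeodesicSpace (X : Type*) [MetricSpace X] : Prop :=
  ∀ x y : X, ∃ γ : ℝ → X, γ 0 = x ∧ γ (dist x y) = y ∧ IsGeodesicOn γ (dist x y)

/-- The path `γ` on `[0, L]` is `M`-Morse: every `(lam, c)`-quasi-geodesic with endpoints
on `γ` stays within distance `M lam c` of the corresponding subpath of `γ`. -/
def IsMorseOn {X : Type*} [MetricSpace X] (γ : ℝ → X) (L : ℝ) (M : ℝ → ℝ → ℝ) : Prop :=
  ∀ lam c : ℝ, 1 ≤ lam → 0 ≤ c →
    ∀ (β : ℝ → X) (Lβ : ℝ), 0 ≤ Lβ → IsQuasiGeodesicOn β Lβ lam c →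
      ∀ s t : ℝ, 0 ≤ s → s ≤ t → t ≤ L → β 0 = γ s → β Lβ = γ t →
        ∀ u ∈ Set.Icc (0:ℝ) Lβ, ∃ v ∈ Set.Icc s t, dist (β u) (γ v) ≤ M lam c

/-- `γ` on `[0, Lγ]` is an `(L; M; lam, c)`-local Morse quasi-geodesic: every subpath of
length at most `L` is an `(M; lam, c)`-Morse quasi-geodesic. -/
def LocalMorseQuasiGeodesicOn {X : Type*} [MetricSpace X] (γ : ℝ → X) (Lγ L : ℝ)
    (M : ℝ → ℝ → ℝ) (lam c : ℝ) : Prop :=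
  ∀ s t : ℝ, 0 ≤ s → s ≤ t → t ≤ Lγ → t - s ≤ L →
    IsQuasiGeodesicOn (fun u => γ (s + u)) (t - s) lam c ∧
    IsMorseOn (fun u => γ (s + u)) (t - s) M

/-- Morse local-to-global space. -/
def MorseLocalToGlobalSpace (X : Type*) [MetricSpace X] : Prop :=
  ∀ (M : ℝ → ℝ → ℝ) (lam c : ℝ), 1 ≤ lam → 0 ≤ c →
    ∃ (M' : ℝ → ℝ → ℝ) (L lam' c' : ℝ), 0 ≤ L ∧ 1 ≤ lam' ∧ 0 ≤ c' ∧
      ∀ (γ : ℝ → X) (Lγ : ℝ), 0 ≤ Lγ → LocalMorseQuasiGeodesicOn γ Lγ L M lam c →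
        IsQuasiGeodesicOn γ Lγ lam' c' ∧ IsMorseOn γ Lγ M'

/-- A Morse geodesic ray: an isometric embedding of `[0, ∞)` which is `M`-Morse. -/
def IsMorseGeodesicRay {X : Type*} [MetricSpace X] (γ : ℝ → X) (M : ℝ → ℝ → ℝ) : Prop :=
  (∀ s t : ℝ, 0 ≤ s → 0 ≤ t → dist (γ s) (γ t) = |s - t|) ∧
  (∀ lam c : ℝ, 1 ≤ lam → 0 ≤ c →
    ∀ (β : ℝ → X) (Lβ : ℝ), 0 ≤ Lβ → IsQuasiGeodesicOn β Lβ lam c →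
      ∀ s t : ℝ, 0 ≤ s → s ≤ t → β 0 = γ s → β Lβ = γ t →
        ∀ u ∈ Set.Icc (0:ℝ) Lβ, ∃ v ∈ Set.Icc s t, dist (β u) (γ v) ≤ M lam c)

/-- The action of `G` on `X` is by isometries. -/
def IsometricAction (G X : Type*) [Group G] [MetricSpace X] [MulAction G X] : Prop :=
  ∀ (g : G) (x y : X), dist (g • x) (g • y) = dist x y

/-- The action of `G` on `X` is (metrically) proper. -/
def ProperAction (G X : Type*) [Group G] [MetricSpace X] [MulAction G X] : Prop :=
  ∀ (x : X) (r : ℝ), 0 < r → {g : G | dist x (g • x) ≤ r}.Finite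

/-- The action of `G` on `X` is cocompact. -/
def CocompactAction (G X : Type*) [Group G] [MetricSpace X] [MulAction G X] : Prop :=
  ∃ K : Set X, IsCompact K ∧ ∀ x : X, ∃ g : G, g • x ∈ K

/-- `H` is a stable subgroup: there are a Morse gauge `M` and `D ≥ 0` such that every
geodesic `[o, h • o]` is `M`-Morse and contained in the `D`-neighborhood of `H • o`. -/
def IsStableSubgroup {X G : Type*} [MetricSpace X] [Group G] [MulAction G X]
    (o : X) (H : Subgroup G) : Prop :=
  ∃ (M : ℝ → ℝ → ℝ) (D : ℝ), 0 ≤ D ∧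
    ∀ h ∈ H, ∀ γ : ℝ → X, γ 0 = o → γ (dist o (h • o)) = h • o →
      IsGeodesicOn γ (dist o (h • o)) →
      IsMorseOn γ (dist o (h • o)) M ∧
      ∀ s ∈ Set.Icc 0 (dist o (h • o)), ∃ h' ∈ H, dist (γ s) (h' • o) ≤ D

/-- A Morse element: an infinite order element generating a stable cyclic subgroup. -/
def IsMorseElement {X G : Type*} [MetricSpace X] [Group G] [MulAction G X]
    (o : X) (g : G) : Prop :=
  ¬ IsOfFinOrder g ∧ IsStableSubgroup o (Subgroup.zpowers g)

/-- `H` is quasi-convex: geodesics with endpoints on `H • o` stay in a `σ`-neighborhood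
of `H • o`. -/
def IsQuasiConvexSubgroup {X G : Type*} [MetricSpace X] [Group G] [MulAction G X]
    (o : X) (H : Subgroup G) : Prop :=
  ∃ σ : ℝ, 0 ≤ σ ∧ ∀ h h' : G, h ∈ H → h' ∈ H →
    ∀ γ : ℝ → X, γ 0 = h • o → γ (dist (h • o) (h' • o)) = h' • o →
      IsGeodesicOn γ (dist (h • o) (h' • o)) →
      ∀ s ∈ Set.Icc 0 (dist (h • o) (h' • o)), ∃ h'' ∈ H, dist (γ s) (h'' • o) ≤ σ

/-- The growth rate `ω(A) = limsup (log #(B(n) ∩ A)) / n` of a subset `A ⊆ G`. -/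
noncomputable def growthRate {X G : Type*} [MetricSpace X] [Group G] [MulAction G X]
    (o : X) (A : Set G) : ℝ :=
  Filter.limsup (fun n : ℕ =>
    Real.log ((A ∩ {g : G | dist o (g • o) ≤ (n : ℝ)}).ncard) / (n : ℝ)) Filter.atTop

/-- Convergence of the Poincaré series `𝒫_A(s) = Σ_{g ∈ A} exp (-s · d_G(1, g))`. -/
def PoincareSummable {X G : Type*} [MetricSpace X] [Group G] [MulAction G X]
    (o : X) (A : Set G) (s : ℝ) : Prop :=
  Summable fun g : A => Real.exp (-s * dist o ((g : G) • o))

/-- A group is virtually cyclic if it has a cyclic subgroup of finite index. -/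
def VirtuallyCyclic (G : Type*) [Group G] : Prop :=
  ∃ H : Subgroup G, IsCyclic H ∧ H.FiniteIndex

/-- The annulus set `𝒜(n, Δ) = {h ∈ H : |d_G(1,h) - n| ≤ Δ}`. -/
def annulus {X G : Type*} [MetricSpace X] [Group G] [MulAction G X]
    (o : X) (H : Subgroup G) (n Δ : ℝ) : Set G :=
  {h : G | h ∈ H ∧ |dist o (h • o) - n| ≤ Δ}

/-- Evaluation of a formal alternating word `a₁b₁a₂b₂⋯aₙbₙ` in `G`. -/
def evalWord {G : Type*} [Group G] (w : List (G × G)) : G :=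
  (w.map fun p => p.1 * p.2).prod

/-- The set `𝕎(A, B)` of (nonempty) formal alternating words with letters in `A` and `B`. -/
def AltWords {G : Type*} [Group G] (A B : Set G) : Set (List (G × G)) :=
  {w | w ≠ [] ∧ ∀ p ∈ w, p.1 ∈ A ∧ p.2 ∈ B}

/-- The nearest-point projection `π_A(x)` of a point to a subset `A ⊆ X`. -/
def projSet {X : Type*} [MetricSpace X] (A : Set X) (x : X) : Set X :=
  {a ∈ A | dist x a = Metric.infDist x A}

/-- The projection `π_A(Y) = ⋃_{y ∈ Y} π_A(y)` of a subset `Y` to `A`. -/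
def projSetOf {X : Type*} [MetricSpace X] (A Y : Set X) : Set X :=
  ⋃ y ∈ Y, projSet A y

/-- The concatenation of a geodesic `[x, a]`, where `a = β u₀` is a nearest
point of a `(lam, c)`-quasi-geodesic `β` to `x`, with the terminal subpath of `β` from `a`,
is a `(2·lam + 1, c)`-quasi-geodesic. -/
theorem concat_geodesic_with_quasi_geodesic_tail
    {X : Type*} [MetricSpace X] (hgeo : GeodesicSpace X)
    (lam c : ℝ) (hlam : 1 ≤ lam) (hc : 0 ≤ c)
    (β : ℝ → X) (Lβ : ℝ) (hLβ : 0 ≤ Lβ) (hβ : IsQuasiGeodesicOn β Lβ lam c)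
    (x : X) (u₀ : ℝ) (hu₀ : u₀ ∈ Set.Icc 0 Lβ)
    (hnear : ∀ s ∈ Set.Icc 0 Lβ, dist x (β u₀) ≤ dist x (β s))
    (δ : ℝ → X) (hδ0 : δ 0 = x) (hδ1 : δ (dist x (β u₀)) = β u₀)
    (hδ : IsGeodesicOn δ (dist x (β u₀))) :
    IsQuasiGeodesicOn
      (fun t => if t ≤ dist x (β u₀) then δ t else β (u₀ + (t - dist x (β u₀))))
      (dist x (β u₀) + (Lβ - u₀)) (2 * lam + 1) c := by
  obtain ⟨hu0, huL⟩ := hu₀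
  obtain ⟨hβ₁, hβ₂⟩ := hβ
  set D := dist x (β u₀) with hD
  have hD0 : 0 ≤ D := dist_nonneg
  refine ⟨fun s t hs hst ht => ?_, fun s t hs hst ht => ?_⟩
  · by_cases htD : t ≤ D
    · have hsD : s ≤ D := hst.trans htD
      simp only [if_pos htD, if_pos hsD]
      rw [hδ s t ⟨hs, hsD⟩ ⟨hs.trans hst, htD⟩, abs_sub_comm, abs_of_nonneg (by linarith)]
    · by_cases hsD : s ≤ D
      · simp only [if_neg htD, if_pos hsD]
        have h₁ := hδ s D ⟨hs, hsD⟩ ⟨hD0, le_rfl⟩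
        rw [hδ1, abs_sub_comm, abs_of_nonneg (by linarith)] at h₁
        have h₂ := hβ₁ u₀ (u₀ + (t - D)) hu0 (by linarith) (by linarith)
        linarith [dist_triangle (δ s) (β u₀) (β (u₀ + (t - D)))]
      · simp only [if_neg htD, if_neg hsD]
        have h := hβ₁ (u₀ + (s - D)) (u₀ + (t - D)) (by linarith) (by linarith) (by linarith)
        linarith
  · by_cases htD : t ≤ D
    · have hsD : s ≤ D := hst.trans htD
      simp only [if_pos htD, if_pos hsD]
      rw [hδ s t ⟨hs, hsD⟩ ⟨hs.trans hst, htD⟩, abs_sub_comm, abs_of_nonneg (by linarith)]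
      nlinarith
    · by_cases hsD : s ≤ D
      · simp only [if_neg htD, if_pos hsD]
        have h₁ := hδ s D ⟨hs, hsD⟩ ⟨hD0, le_rfl⟩
        rw [hδ1, abs_sub_comm, abs_of_nonneg (by linarith)] at h₁
        have h₂ := hδ 0 s ⟨le_rfl, hD0⟩ ⟨hs, hsD⟩
        rw [hδ0, zero_sub, abs_neg, abs_of_nonneg hs] at h₂
        have h₃ := hβ₂ u₀ (u₀ + (t - D)) hu0 (by linarith) (by linarith)
        have h₄ := hnear (u₀ + (t - D)) ⟨by linarith, by linarith⟩
        have h₅ := dist_triangle x (δ s) (β (u₀ + (t - D)))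
        have h₆ := dist_triangle (β u₀) (δ s) (β (u₀ + (t - D)))
        rw [dist_comm (β u₀) (δ s)] at h₆
        have h₇ : dist (β u₀) (β (u₀ + (t - D))) ≤ 2 * dist (δ s) (β (u₀ + (t - D))) := by
          linarith
        have h₈ := mul_le_mul_of_nonneg_left h₇ (zero_le_one.trans hlam)
        linarith
      · simp only [if_neg htD, if_neg hsD]
        have h := hβ₂ (u₀ + (s - D)) (u₀ + (t - D)) (by linarith) (by linarith) (by linarith)
        have hd : 0 ≤ (lam + 1) * dist (β (u₀ + (s - D))) (β (u₀ + (t - D))) :=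
          mul_nonneg (by linarith) dist_nonneg
        linarith
end

section
/- Let X be a geodesic metric space, M₀ a Morse gauge, and C₁ ≥ 0. Let α be a geodesic from x to o and β a geodesic from o to y, both M₀-Morse, such that diam π_α(β) ≤ C₁ and diam π_β(α) ≤ C₁. Then every subpath of the concatenation α·β is a (3, 2C₁)-quasi-geodesic which is M-Morse, where M is the Morse gauge defined by M(λ,c) = M₀(2λ+1, c). -/
open Metric Set Filter Pointwise

/-- The concatenation of `f`, parametrized on `[0, a]`, with `g`, parametrized from `0`. -/
noncomputable def pathConcat {X : Type*} (f : ℝ → X) (a : ℝ) (g : ℝ → X) : ℝ → X :=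
  fun v => if v ≤ a then f v else g (v - a)

section

variable {X : Type*}

theorem pathConcat_of_le {f g : ℝ → X} {a v : ℝ} (h : v ≤ a) : pathConcat f a g v = f v :=
  if_pos h

theorem pathConcat_of_ge {f g : ℝ → X} {a v : ℝ} (hfg : f a = g 0) (h : a ≤ v) :
    pathConcat f a g v = g (v - a) := by
  rcases h.eq_or_lt with rfl | h
  · simp [pathConcat, hfg]
  · exact if_neg (not_le.2 h)

variable [MetricSpace X]

theorem dist_pathConcat_le {f g : ℝ → X} {a b : ℝ}
    (hf : ∀ s t : ℝ, 0 ≤ s → s ≤ t → t ≤ a → dist (f s) (f t) ≤ t - s)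
    (hg : ∀ s t : ℝ, 0 ≤ s → s ≤ t → t ≤ b → dist (g s) (g t) ≤ t - s)
    (hfg : f a = g 0) (s t : ℝ) (hs : 0 ≤ s) (hst : s ≤ t) (ht : t ≤ a + b) :
    dist (pathConcat f a g s) (pathConcat f a g t) ≤ t - s := by
  rcases le_total t a with h | h
  · rw [pathConcat_of_le h, pathConcat_of_le (hst.trans h)]
    exact hf s t hs hst h
  rcases le_total a s with h' | h'
  · rw [pathConcat_of_ge hfg h, pathConcat_of_ge hfg h']
    have := hg (s - a) (t - a) (by linarith) (by linarith) (by linarith)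
    linarith
  · rw [pathConcat_of_ge hfg h, pathConcat_of_le h']
    have h1 := hf s a hs h' le_rfl
    have h2 := hg 0 (t - a) le_rfl (by linarith) (by linarith)
    have h3 := dist_triangle (f s) (f a) (g (t - a))
    rw [hfg] at h1 h3
    linarith

/-- The lower bound of `IsQuasiGeodesicOn` for a concatenation follows from that for
the two pieces and for pairs of points on different pieces. -/
theorem le_dist_pathConcat {f g : ℝ → X} {a b lam c : ℝ}
    (hf : ∀ s t : ℝ, 0 ≤ s → s ≤ t → t ≤ a → t - s ≤ lam * dist (f s) (f t) + c)
    (hg : ∀ s t : ℝ, 0 ≤ s → s ≤ t → t ≤ b → t - s ≤ lam * dist (g s) (g t) + c)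
    (hfg : f a = g 0)
    (hmix : ∀ s t : ℝ, 0 ≤ s → s ≤ a → 0 ≤ t → t ≤ b →
      a - s + t ≤ lam * dist (f s) (g t) + c)
    (s t : ℝ) (hs : 0 ≤ s) (hst : s ≤ t) (ht : t ≤ a + b) :
    t - s ≤ lam * dist (pathConcat f a g s) (pathConcat f a g t) + c := by
  rcases le_total t a with h | h
  · rw [pathConcat_of_le h, pathConcat_of_le (hst.trans h)]
    exact hf s t hs hst h
  rcases le_total a s with h' | h'
  · rw [pathConcat_of_ge hfg h, pathConcat_of_ge hfg h']
    have := hg (s - a) (t - a) (by linarith) (by linarith) (by linarith)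
    linarith
  · rw [pathConcat_of_ge hfg h, pathConcat_of_le h']
    have := hmix s (t - a) hs h' (by linarith) (by linarith)
    linarith

theorem IsGeodesicOn.dist_eq {η : ℝ → X} {L : ℝ} (h : IsGeodesicOn η L) {s t : ℝ}
    (hs : 0 ≤ s) (hst : s ≤ t) (ht : t ≤ L) : dist (η s) (η t) = t - s := by
  rw [h s t ⟨hs, hst.trans ht⟩ ⟨hs.trans hst, ht⟩, abs_of_nonpos (by linarith)]
  ring

theorem IsGeodesicOn.isQuasiGeodesicOn {η : ℝ → X} {L lam c : ℝ} (h : IsGeodesicOn η L)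
    (hlam : 1 ≤ lam) (hc : 0 ≤ c) : IsQuasiGeodesicOn η L lam c := by
  refine ⟨fun s t hs hst ht => (h.dist_eq hs hst ht).le, fun s t hs hst ht => ?_⟩
  rw [h.dist_eq hs hst ht]
  nlinarith

theorem IsQuasiGeodesicOn.mono_const {γ : ℝ → X} {L lam lam' c : ℝ}
    (h : IsQuasiGeodesicOn γ L lam c) (hlam : lam ≤ lam') : IsQuasiGeodesicOn γ L lam' c := by
  refine ⟨h.1, fun s t hs hst ht => (h.2 s t hs hst ht).trans ?_⟩
  gcongr

theorem IsQuasiGeodesicOn.subpath {γ : ℝ → X} {L lam c : ℝ}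
    (h : IsQuasiGeodesicOn γ L lam c) {s t : ℝ} (hs : 0 ≤ s) (ht : t ≤ L) :
    IsQuasiGeodesicOn (fun u => γ (s + u)) (t - s) lam c := by
  constructor <;> intro a b ha hab hb
  · have := h.1 (s + a) (s + b) (by linarith) (by linarith) (by linarith)
    linarith
  · have := h.2 (s + a) (s + b) (by linarith) (by linarith) (by linarith)
    linarith

theorem IsMorseOn.subpath {γ : ℝ → X} {L : ℝ} {M : ℝ → ℝ → ℝ} (h : IsMorseOn γ L M)
    {s t : ℝ} (hs : 0 ≤ s) (ht : t ≤ L) : IsMorseOn (fun u => γ (s + u)) (t - s) M := by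
  intro lam c hlam hc η Lη hLη hη a b ha hab hb h0 h1 u hu
  obtain ⟨v, hv, hd⟩ := h lam c hlam hc η Lη hLη hη (s + a) (s + b) (by linarith)
    (by linarith) (by linarith) h0 h1 u hu
  refine ⟨v - s, ⟨by linarith [hv.1], by linarith [hv.2]⟩, ?_⟩
  simpa using hd

theorem IsQuasiGeodesicOn.continuousOn {γ : ℝ → X} {L lam c : ℝ}
    (h : IsQuasiGeodesicOn γ L lam c) : ContinuousOn γ (Icc 0 L) := by
  refine (LipschitzOnWith.of_dist_le_mul (K := 1) fun s hs t ht => ?_).continuousOn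
  rw [NNReal.coe_one, one_mul, Real.dist_eq]
  rcases le_total s t with hst | hst
  · rw [abs_of_nonpos (by linarith)]
    linarith [h.1 s t hs.1 hst ht.2]
  · rw [abs_of_nonneg (by linarith), dist_comm]
    exact h.1 t s ht.1 hst hs.2

/-- Extending a quasi-geodesic by a geodesic from its endpoint to a point for which that
endpoint is a nearest point. -/
theorem IsQuasiGeodesicOn.append_geodesic {γ η : ℝ → X} {L D lam c : ℝ}
    (hD : 0 ≤ D) (hlam : 1 ≤ lam) (hc : 0 ≤ c) (hγ : IsQuasiGeodesicOn γ L lam c)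
    (hη : IsGeodesicOn η D) (hγη : γ L = η 0)
    (hmin : ∀ u ∈ Icc 0 L, dist (γ L) (η D) ≤ dist (γ u) (η D)) :
    IsQuasiGeodesicOn (pathConcat γ L η) (L + D) (2 * lam + 1) c := by
  have hη' : IsQuasiGeodesicOn η D (2 * lam + 1) c := hη.isQuasiGeodesicOn (by linarith) hc
  refine ⟨dist_pathConcat_le hγ.1 hη'.1 hγη,
    le_dist_pathConcat (hγ.mono_const (by linarith)).2 hη'.2 hγη ?_⟩
  intro s t hs hsL ht htD
  have h1 := hmin s ⟨hs, hsL⟩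
  have h2 := hγ.2 s L hs hsL le_rfl
  have h3 := dist_triangle (γ s) (η t) (η D)
  have h4 := dist_triangle (γ s) (η t) (γ L)
  rw [hγη, hη.dist_eq le_rfl hD le_rfl] at h1
  rw [hη.dist_eq ht htD le_rfl] at h3
  rw [hγη, dist_comm (η t), hη.dist_eq le_rfl ht htD] at h4
  rw [hγη] at h2
  have h5 : t ≤ dist (γ s) (η t) := by linarith
  have h6 : lam * dist (γ s) (η 0) ≤ lam * (2 * dist (γ s) (η t)) := by
    gcongr
    linarith
  linarith

/-- Extending a quasi-geodesic by a geodesic to its starting point from a point for which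
that starting point is a nearest point. -/
theorem IsQuasiGeodesicOn.prepend_geodesic {γ η : ℝ → X} {L D lam c : ℝ}
    (hD : 0 ≤ D) (hlam : 1 ≤ lam) (hc : 0 ≤ c) (hγ : IsQuasiGeodesicOn γ L lam c)
    (hη : IsGeodesicOn η D) (hηγ : η D = γ 0)
    (hmin : ∀ u ∈ Icc 0 L, dist (γ 0) (η 0) ≤ dist (γ u) (η 0)) :
    IsQuasiGeodesicOn (pathConcat η D γ) (D + L) (2 * lam + 1) c := by
  have hη' : IsQuasiGeodesicOn η D (2 * lam + 1) c := hη.isQuasiGeodesicOn (by linarith) hc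
  refine ⟨dist_pathConcat_le hη'.1 hγ.1 hηγ,
    le_dist_pathConcat hη'.2 (hγ.mono_const (by linarith)).2 hηγ ?_⟩
  intro s t hs hsD ht htL
  have h1 := hmin t ⟨ht, htL⟩
  have h2 := hγ.2 0 t le_rfl ht htL
  have h3 := dist_triangle (γ t) (η s) (η 0)
  have h4 := dist_triangle (γ t) (η s) (γ 0)
  rw [dist_comm (γ t) (η s)] at h3 h4
  rw [← hηγ, dist_comm (η D), hη.dist_eq le_rfl hD le_rfl] at h1
  rw [dist_comm (η s) (η 0), hη.dist_eq le_rfl hs hsD] at h3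
  rw [← hηγ, hη.dist_eq hs hsD le_rfl] at h4
  rw [← hηγ, dist_comm (η D)] at h2
  have h5 : D - s ≤ dist (η s) (γ t) := by linarith
  have h6 : lam * dist (γ t) (η D) ≤ lam * (2 * dist (η s) (γ t)) := by
    gcongr
    linarith
  linarith

/-- If the projection to a compact set `A` of a set `B` meeting `A` in `o` has diameter at
most `C`, then every `q ∈ B` has a nearest point in `A` within distance `C` of `o`. -/
theorem exists_nearest_dist_le {A B : Set X} (hA : IsCompact A) {C : ℝ}
    (hdiam : Metric.diam (projSetOf A B) ≤ C) {o q : X} (hoA : o ∈ A) (hoB : o ∈ B)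
    (hq : q ∈ B) : ∃ z ∈ A, dist q z = Metric.infDist q A ∧ dist z o ≤ C := by
  obtain ⟨z, hz, hqz⟩ := hA.exists_infDist_eq_dist ⟨o, hoA⟩ q
  refine ⟨z, hz, hqz.symm, le_trans (Metric.dist_le_diam_of_mem ?_ ?_ ?_) hdiam⟩
  · refine hA.isBounded.subset fun a ha => ?_
    simp only [projSetOf, mem_iUnion] at ha
    obtain ⟨_, _, h⟩ := ha
    exact h.1
  · simp only [projSetOf, mem_iUnion]
    exact ⟨q, hq, hz, hqz.symm⟩
  · simp only [projSetOf, mem_iUnion]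
    exact ⟨o, hoB, hoA, by rw [dist_self, Metric.infDist_zero_of_mem hoA]⟩

/-- Two geodesics sharing an endpoint, the second having bounded projection to the first,
concatenate to a quasi-geodesic. -/
theorem isQuasiGeodesicOn_pathConcat {α β : ℝ → X} {Lα Lβ C : ℝ} (hLα : 0 ≤ Lα)
    (hLβ : 0 ≤ Lβ) (hC : 0 ≤ C) (hα : IsGeodesicOn α Lα) (hβ : IsGeodesicOn β Lβ)
    (hαβ : α Lα = β 0)
    (hproj : Metric.diam (projSetOf (α '' Icc 0 Lα) (β '' Icc 0 Lβ)) ≤ C) :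
    IsQuasiGeodesicOn (pathConcat α Lα β) (Lα + Lβ) 3 (2 * C) := by
  have hα' : IsQuasiGeodesicOn α Lα 3 (2 * C) :=
    hα.isQuasiGeodesicOn (by norm_num) (by linarith)
  have hβ' : IsQuasiGeodesicOn β Lβ 3 (2 * C) :=
    hβ.isQuasiGeodesicOn (by norm_num) (by linarith)
  refine ⟨dist_pathConcat_le hα'.1 hβ'.1 hαβ,
    le_dist_pathConcat hα'.2 hβ'.2 hαβ ?_⟩
  intro s t hs hsα ht htβ
  obtain ⟨z, -, hz, hzo⟩ := exists_nearest_dist_le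
    (isCompact_Icc.image_of_continuousOn hα'.continuousOn) hproj
    (o := α Lα) (q := β t) ⟨Lα, ⟨hLα, le_rfl⟩, rfl⟩ ⟨0, ⟨le_rfl, hLβ⟩, hαβ.symm⟩
    ⟨t, ⟨ht, htβ⟩, rfl⟩
  have h1 : dist (β t) z ≤ dist (β t) (α s) :=
    hz.trans_le (Metric.infDist_le_dist_of_mem ⟨s, ⟨hs, hsα⟩, rfl⟩)
  have h2 := dist_triangle (β t) z (α Lα)
  have h3 := dist_triangle (α s) (β t) (α Lα)
  rw [hα.dist_eq hs hsα le_rfl] at h3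
  rw [hαβ, dist_comm (β t) (β 0), hβ.dist_eq le_rfl ht htβ] at h2 h3
  rw [dist_comm (β t) (α s)] at h1
  rw [hαβ] at hzo
  linarith

/-- Concatenating Morse paths in a geodesic space gives a Morse path. -/
theorem isMorseOn_pathConcat (hgeo : GeodesicSpace X) {α β : ℝ → X} {Lα Lβ : ℝ}
    {M : ℝ → ℝ → ℝ} (hαβ : α Lα = β 0) (hα : IsMorseOn α Lα M) (hβ : IsMorseOn β Lβ M) :
    IsMorseOn (pathConcat α Lα β) (Lα + Lβ) (fun lam c => M (2 * lam + 1) c) := by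
  intro lam c hlam hc γ L hL hγ s t hs hst ht h0 h1 u hu
  have hlam' : 1 ≤ 2 * lam + 1 := by linarith
  rcases le_total t Lα with h | h
  · rw [pathConcat_of_le (hst.trans h)] at h0
    rw [pathConcat_of_le h] at h1
    obtain ⟨v, hv, hd⟩ := hα _ c hlam' hc γ L hL (hγ.mono_const (by linarith)) s t hs hst h
      h0 h1 u hu
    exact ⟨v, hv, by rwa [pathConcat_of_le (hv.2.trans h)]⟩
  rw [pathConcat_of_ge hαβ h] at h1
  rcases le_total Lα s with h' | h'
  · rw [pathConcat_of_ge hαβ h'] at h0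
    obtain ⟨v, hv, hd⟩ := hβ _ c hlam' hc γ L hL (hγ.mono_const (by linarith)) (s - Lα)
      (t - Lα) (by linarith) (by linarith) (by linarith) h0 h1 u hu
    refine ⟨v + Lα, ⟨by linarith [hv.1], by linarith [hv.2]⟩, ?_⟩
    rwa [pathConcat_of_ge hαβ (by linarith [hv.1]), add_sub_cancel_right]
  rw [pathConcat_of_le h'] at h0
  obtain ⟨w, hw, hmin⟩ := isCompact_Icc.exists_isMinOn (nonempty_Icc.2 hL)
    ((continuous_id.dist (continuous_const (y := α Lα))).comp_continuousOn hγ.continuousOn)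
  have hmin' : ∀ r ∈ Icc 0 L, dist (γ w) (α Lα) ≤ dist (γ r) (α Lα) := fun r hr => hmin hr
  rcases le_total u w with huw | hwu
  · obtain ⟨η, hη0, hη1, hη⟩ := hgeo (γ w) (α Lα)
    set D := dist (γ w) (α Lα)
    have hD : 0 ≤ D := dist_nonneg
    have hγw : IsQuasiGeodesicOn γ w lam c := by
      simpa using hγ.subpath (s := 0) le_rfl hw.2
    have hq := hγw.append_geodesic hD hlam hc hη hη0.symm fun r hr => by
      rw [hη1]
      exact hmin' r ⟨hr.1, hr.2.trans hw.2⟩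
    obtain ⟨v, hv, hd⟩ := hα _ c hlam' hc _ _ (add_nonneg hw.1 hD) hq s Lα hs h' le_rfl
      (by rw [pathConcat_of_le hw.1, h0])
      (by rw [pathConcat_of_ge hη0.symm (by linarith), add_sub_cancel_left, hη1])
      u ⟨hu.1, by linarith⟩
    rw [pathConcat_of_le huw] at hd
    exact ⟨v, ⟨hv.1, hv.2.trans h⟩, by rwa [pathConcat_of_le hv.2]⟩
  · obtain ⟨η, hη0, hη1, hη⟩ := hgeo (α Lα) (γ w)
    set D := dist (α Lα) (γ w)
    have hD : 0 ≤ D := dist_nonneg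
    have hηγ : η D = γ (w + 0) := by rw [hη1, add_zero]
    have hq := (hγ.subpath (s := w) hw.1 le_rfl).prepend_geodesic hD
      hlam hc hη hηγ fun r hr => by
        rw [hη0, add_zero]
        exact hmin' (w + r) ⟨by linarith [hw.1, hr.1], by linarith [hr.2]⟩
    obtain ⟨v, hv, hd⟩ := hβ _ c hlam' hc _ _ (by linarith [hw.2]) hq 0 (t - Lα) le_rfl
      (by linarith) (by linarith)
      (by rw [pathConcat_of_le hD, hη0, hαβ])
      (by
        rw [pathConcat_of_ge (by exact hηγ) (by linarith [hw.2]), add_sub_cancel_left,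
          add_sub_cancel, h1])
      (D + (u - w)) ⟨by linarith, by linarith [hu.2]⟩
    rw [pathConcat_of_ge (by exact hηγ) (by linarith), add_sub_cancel_left,
      add_sub_cancel] at hd
    refine ⟨v + Lα, ⟨by linarith [hv.1], by linarith [hv.2]⟩, ?_⟩
    rwa [pathConcat_of_ge hαβ (by linarith [hv.1]), add_sub_cancel_right]

end

/-- If `α` is an `M₀`-Morse geodesic from `x` to `o` and `β` an `M₀`-Morse
geodesic from `o` to `y`, with mutual projections of diameter at most `C₁`, then every
subpath of the concatenation `α · β` is a `(3, 2C₁)`-quasi-geodesic which is `M`-Morse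
for `M(lam, c) = M₀(2·lam + 1, c)`. -/
theorem concat_of_morse_geodesics_is_morse
    {X : Type*} [MetricSpace X] (hgeo : GeodesicSpace X)
    (M₀ : ℝ → ℝ → ℝ) (C₁ : ℝ) (hC₁ : 0 ≤ C₁)
    (x o y : X)
    (α : ℝ → X) (Lα : ℝ) (hLα : 0 ≤ Lα)
    (hα0 : α 0 = x) (hα1 : α Lα = o) (hαgeo : IsGeodesicOn α Lα)
    (hαM : IsMorseOn α Lα M₀)
    (β : ℝ → X) (Lβ : ℝ) (hLβ : 0 ≤ Lβ)
    (hβ0 : β 0 = o) (hβ1 : β Lβ = y) (hβgeo : IsGeodesicOn β Lβ)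
    (hβM : IsMorseOn β Lβ M₀)
    (hproj1 : Metric.diam (projSetOf (α '' Set.Icc 0 Lα) (β '' Set.Icc 0 Lβ)) ≤ C₁)
    (hproj2 : Metric.diam (projSetOf (β '' Set.Icc 0 Lβ) (α '' Set.Icc 0 Lα)) ≤ C₁) :
    ∀ s t : ℝ, 0 ≤ s → s ≤ t → t ≤ Lα + Lβ →
      IsQuasiGeodesicOn
        (fun u => if s + u ≤ Lα then α (s + u) else β (s + u - Lα)) (t - s) 3 (2 * C₁) ∧
      IsMorseOn
        (fun u => if s + u ≤ Lα then α (s + u) else β (s + u - Lα)) (t - s)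
        (fun lam c => M₀ (2 * lam + 1) c) := by
  intro s t hs _ ht
  have hαβ : α Lα = β 0 := hα1.trans hβ0.symm
  exact ⟨(isQuasiGeodesicOn_pathConcat hLα hLβ hC₁ hαgeo hβgeo hαβ hproj1).subpath hs ht,
    (isMorseOn_pathConcat hgeo hαβ hαM hβM).subpath hs ht⟩
end
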